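/- arXiv:math/0405136 — 2 statements merged into one kernel-verified Lean document; each statement's English description precedes it below -/
import Mathlib

section
/- Let 1 ≤ m ≤ k and let λ, μ ∈ L^k(m,n), i.e., λ ≼ (m^n) and μ ≼ (m^n) in the k-Young order. Then μ is covered by λ in the k-Young order (μ ⋖ λ) if and only if μ ⊆ λ and |λ| = |μ| + 1. -/
/-- A partition: a weakly decreasing list of positive integers. -/
def IsPartition (l : List ℕ) : Prop :=
  l.Pairwise (· ≥ ·) ∧ ∀ x ∈ l, 0 < x

/-- The `i`-th part (0-indexed), with parts beyond the length equal to 0. -/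
def part (l : List ℕ) (i : ℕ) : ℕ := l.getD i 0

/-- Diagram containment `l ⊆ m`: every part of `l` is at most the corresponding part of `m`. -/
def SubDiag (l m : List ℕ) : Prop := ∀ i, part l i ≤ part m i

/-- A `k`-bounded partition: a partition whose first part is at most `k`. -/
def KBounded (k : ℕ) (l : List ℕ) : Prop := IsPartition l ∧ part l 0 ≤ k

/-- Hook length of the square `(i,j)` (0-indexed) with respect to the skew diagram
`outer/inner`: the number of cells `(i,j')` of the skew diagram with `j' ≥ j` plus the
number of cells `(i',j)` of the skew diagram with `i' > i`. -/
def hookLen (outer inner : List ℕ) (i j : ℕ) : ℕ :=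
  ((Finset.range (part outer i)).filter (fun j' => j ≤ j' ∧ part inner i ≤ j')).card +
  ((Finset.range outer.length).filter
    (fun i' => i < i' ∧ part inner i' ≤ j ∧ j < part outer i')).card

/-- `(outer, inner)` is the `k`-skew diagram of the `k`-bounded partition `l`:
row `i` of `outer/inner` has `l i` cells, every cell of `outer/inner` has hook length
at most `k`, and every square of the inner shape has hook length exceeding `k`. -/
def IsKSkew (k : ℕ) (l outer inner : List ℕ) : Prop :=
  IsPartition outer ∧ IsPartition inner ∧ SubDiag inner outer ∧
  (∀ i, part outer i - part inner i = part l i) ∧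
  (∀ i j, part inner i ≤ j → j < part outer i → hookLen outer inner i j ≤ k) ∧
  (∀ i j, j < part inner i → k < hookLen outer inner i j)

/-- Length of column `j` of the skew diagram `outer/inner`. -/
def colLen (outer inner : List ℕ) (j : ℕ) : ℕ :=
  ((Finset.range outer.length).filter
    (fun i => part inner i ≤ j ∧ j < part outer i)).card

/-- The list of column lengths of the skew diagram `outer/inner`. -/
def skewCols (outer inner : List ℕ) : List ℕ :=
  ((List.range (part outer 0)).map (colLen outer inner)).filter (fun x => decide (x ≠ 0))

/-- The `k`-conjugate of `l`: the partition whose parts are the column lengths of the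
(unique) `k`-skew diagram of `l`. -/
noncomputable def kConj (k : ℕ) (l : List ℕ) : List ℕ :=
  haveI := Classical.dec (∃ p : List ℕ × List ℕ, IsKSkew k l p.1 p.2)
  if h : ∃ p : List ℕ × List ℕ, IsKSkew k l p.1 p.2 then
    skewCols h.choose.1 h.choose.2
  else []

/-- The covering relation of the `k`-Young order on `k`-bounded partitions. -/
def KCover (k : ℕ) (l m : List ℕ) : Prop :=
  KBounded k l ∧ KBounded k m ∧ SubDiag l m ∧
  SubDiag (kConj k l) (kConj k m) ∧ m.sum = l.sum + 1

/-- The `k`-Young order: reflexive-transitive closure of the covering relation. -/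
def KLe (k : ℕ) : List ℕ → List ℕ → Prop := Relation.ReflTransGen (KCover k)

/-- The weakly decreasing rearrangement of the combined parts of two partitions. -/
def punion (l r : List ℕ) : List ℕ := (l ++ r).mergeSort (fun a b => decide (a ≥ b))

/-- The ordinary conjugate of a partition: the list of column lengths of its diagram. -/
def conj (l : List ℕ) : List ℕ :=
  (List.range (part l 0)).map (fun j => (l.filter (fun x => decide (j < x))).length)

theorem part_tail (l : List ℕ) (i : ℕ) : part l.tail i = part l (i + 1) := by
  cases l <;> simp [part]

theorem part_cons_zero (a : ℕ) (l : List ℕ) : part (a :: l) 0 = a := by simp [part]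

theorem part_cons_succ (a : ℕ) (l : List ℕ) (i : ℕ) : part (a :: l) (i + 1) = part l i := by
  simp [part]

theorem part_nil (i : ℕ) : part [] i = 0 := by simp [part]

theorem part_mem_or_eq_zero (l : List ℕ) (i : ℕ) : part l i ∈ l ∨ part l i = 0 := by
  by_cases h : i < l.length
  · left
    simp [part, h]
  · right
    simp [part, not_lt.mp h]

theorem exists_part_eq_of_mem {l : List ℕ} {x : ℕ} (hx : x ∈ l) : ∃ i, part l i = x := by
  obtain ⟨i, hi, rfl⟩ := List.mem_iff_getElem.mp hx
  exact ⟨i, by simp [part, hi]⟩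

theorem IsPartition.tail {l : List ℕ} (h : IsPartition l) : IsPartition l.tail := by
  cases l with
  | nil => exact h
  | cons a t => exact ⟨(List.pairwise_cons.mp h.1).2, fun x hx => h.2 x (List.mem_cons_of_mem _ hx)⟩

theorem IsPartition.le_part_zero {l : List ℕ} (h : IsPartition l) {x : ℕ} (hx : x ∈ l) :
    x ≤ part l 0 := by
  cases l with
  | nil => simp at hx
  | cons a t =>
    rw [part_cons_zero]
    rcases List.mem_cons.mp hx with rfl | hx
    · exact le_rfl
    · exact (List.pairwise_cons.mp h.1).1 x hx

theorem IsPartition.part_le_part_zero {l : List ℕ} (h : IsPartition l) (i : ℕ) :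
    part l i ≤ part l 0 := by
  rcases part_mem_or_eq_zero l i with h' | h'
  · exact h.le_part_zero h'
  · omega

theorem IsPartition.cons {l : List ℕ} {a : ℕ} (h : IsPartition l) (ha : 0 < a)
    (hl : part l 0 ≤ a) : IsPartition (a :: l) := by
  refine ⟨List.pairwise_cons.mpr ⟨fun x hx => (h.le_part_zero hx).trans hl, h.1⟩, fun x hx => ?_⟩
  rcases List.mem_cons.mp hx with rfl | hx
  · exact ha
  · exact h.2 x hx

theorem IsPartition.eq_nil {l : List ℕ} (h : IsPartition l) (h0 : part l 0 = 0) : l = [] := by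
  cases l with
  | nil => rfl
  | cons a t =>
    have := h.2 a (by simp)
    rw [part_cons_zero] at h0
    omega

/-- A partition can be extended by any first part which is at least as large as its own. -/
theorem IsPartition.exists_tail_eq {l : List ℕ} (h : IsPartition l) {a : ℕ}
    (ha : part l 0 ≤ a) : ∃ l', IsPartition l' ∧ part l' 0 = a ∧ l'.tail = l := by
  rcases Nat.eq_zero_or_pos a with rfl | ha0
  · have := h.eq_nil (by omega)
    subst this
    exact ⟨[], h, part_nil 0, rfl⟩
  · exact ⟨a :: l, h.cons ha0 ha, part_cons_zero a l, rfl⟩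

theorem KBounded.of_cons {k a : ℕ} {l : List ℕ} (h : KBounded k (a :: l)) :
    KBounded k l ∧ 0 < a ∧ a ≤ k ∧ part l 0 ≤ a := by
  have h1 := h.1.part_le_part_zero 1
  have h2 := h.2
  rw [part_cons_succ, part_cons_zero] at h1
  rw [part_cons_zero] at h2
  exact ⟨⟨h.1.tail, h1.trans h2⟩, h.1.2 a (by simp), h2, h1⟩

theorem card_filter_range_succ (n : ℕ) (p : ℕ → Prop) [DecidablePred p] :
    ((Finset.range (n + 1)).filter p).card =
      (if p 0 then 1 else 0) + ((Finset.range n).filter (fun i => p (i + 1))).card := by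
  simp only [Finset.card_filter, Finset.sum_range_succ']
  exact add_comm _ _

theorem colLen_tail (o i : List ℕ) (c : ℕ) :
    colLen o i c =
      (if part i 0 ≤ c ∧ c < part o 0 then 1 else 0) + colLen o.tail i.tail c := by
  cases o with
  | nil => simp [colLen, part]
  | cons a t =>
    simp only [colLen, List.length_cons, List.tail_cons, part_tail]
    rw [card_filter_range_succ]
    simp only [part_cons_succ]

theorem hookLen_zero (o i : List ℕ) (c : ℕ) :
    hookLen o i 0 c = (part o 0 - max c (part i 0)) + colLen o.tail i.tail c := by
  unfold hookLen
  congr 1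
  · have : (Finset.range (part o 0)).filter (fun j' => c ≤ j' ∧ part i 0 ≤ j')
        = Finset.Ico (max c (part i 0)) (part o 0) := by
      ext j
      simp only [Finset.mem_filter, Finset.mem_range, Finset.mem_Ico, max_le_iff]
      tauto
    rw [this, Nat.card_Ico]
  · cases o with
    | nil => simp [colLen, part_nil]
    | cons a t =>
      simp only [colLen, List.length_cons, List.tail_cons, part_tail]
      rw [card_filter_range_succ]
      simp [part_cons_succ]

theorem hookLen_succ (o i : List ℕ) (r c : ℕ) :
    hookLen o i (r + 1) c = hookLen o.tail i.tail r c := by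
  unfold hookLen
  simp only [part_tail]
  congr 1
  cases o with
  | nil => simp
  | cons a t =>
    simp only [List.length_cons, List.tail_cons]
    rw [card_filter_range_succ]
    simp [part_cons_succ]

theorem colLen_eq_zero {o i : List ℕ} {c : ℕ} (ho : IsPartition o) (hc : part o 0 ≤ c) :
    colLen o i c = 0 := by
  simp only [colLen, Finset.card_eq_zero, Finset.filter_eq_empty_iff]
  intro r _ h
  have := ho.part_le_part_zero r
  omega

/-- The first column in which a row of `x` cells placed below columns of heights `C` has
leftmost hook length at most `k`. -/
noncomputable def rowStart (k x : ℕ) (C : ℕ → ℕ) : ℕ := sInf {j | x + C j ≤ k}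

/-- The column heights of the `k`-skew diagram of `l`, built row by row from the top. -/
noncomputable def colHt (k : ℕ) : List ℕ → ℕ → ℕ
  | [] => fun _ => 0
  | x :: t => fun j => colHt k t j +
      if rowStart k x (colHt k t) ≤ j ∧ j < rowStart k x (colHt k t) + x then 1 else 0

theorem colHt_cons (k x : ℕ) (t : List ℕ) (j : ℕ) :
    colHt k (x :: t) j = colHt k t j +
      if rowStart k x (colHt k t) ≤ j ∧ j < rowStart k x (colHt k t) + x then 1 else 0 := rfl

theorem rowStart_spec {k x : ℕ} {C : ℕ → ℕ} (h : ∃ j, x + C j ≤ k) :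
    x + C (rowStart k x C) ≤ k := Nat.sInf_mem (s := {j | x + C j ≤ k}) h

theorem lt_of_lt_rowStart {k x : ℕ} {C : ℕ → ℕ} {j : ℕ} (h : j < rowStart k x C) :
    k < x + C j := not_le.mp (Nat.notMem_of_lt_sInf (s := {j | x + C j ≤ k}) h)

theorem rowStart_le {k x : ℕ} {C : ℕ → ℕ} {j : ℕ} (h : x + C j ≤ k) :
    rowStart k x C ≤ j := Nat.sInf_le (s := {j | x + C j ≤ k}) h

theorem rowStart_eq {k x : ℕ} {C : ℕ → ℕ} {j : ℕ} (h : x + C j ≤ k)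
    (h' : ∀ c < j, k < x + C c) : rowStart k x C = j := by
  refine le_antisymm (rowStart_le h) (not_lt.mp fun hlt => ?_)
  have := h' _ hlt
  have := rowStart_spec ⟨j, h⟩
  omega

theorem IsKSkew.tail {k x : ℕ} {t o i : List ℕ} (h : IsKSkew k (x :: t) o i) :
    IsKSkew k t o.tail i.tail := by
  obtain ⟨ho, hi, hsub, hrow, hcell, hinner⟩ := h
  refine ⟨ho.tail, hi.tail, fun r => ?_, fun r => ?_, fun r c => ?_, fun r c => ?_⟩
  · simpa only [part_tail] using hsub (r + 1)
  · simpa only [part_tail, part_cons_succ] using hrow (r + 1)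
  · simpa only [part_tail, hookLen_succ] using hcell (r + 1) c
  · simpa only [part_tail, hookLen_succ] using hinner (r + 1) c

theorem IsKSkew.colLen_eq {k : ℕ} {l o i : List ℕ} (hl : KBounded k l) (h : IsKSkew k l o i)
    (c : ℕ) : colLen o i c = colHt k l c := by
  induction l generalizing o i c with
  | nil =>
    have hrow := h.2.2.2.1
    simp only [colLen, colHt, Finset.card_eq_zero, Finset.filter_eq_empty_iff]
    intro r _ hr
    have := hrow r
    rw [part_nil] at this
    omega
  | cons x t ih =>
    obtain ⟨ht, hx, -, -⟩ := hl.of_cons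
    have ih' := ih ht h.tail
    obtain ⟨-, -, -, hrow, hcell, hinner⟩ := h
    have hrow0 := hrow 0
    rw [part_cons_zero] at hrow0
    have hs : rowStart k x (colHt k t) = part i 0 := by
      apply rowStart_eq
      · have := hcell 0 (part i 0) le_rfl (by omega)
        rw [hookLen_zero, max_self, ih'] at this
        omega
      · intro c hc
        have := hinner 0 c hc
        rw [hookLen_zero, max_eq_right hc.le, ih'] at this
        omega
    have ho : part o 0 = part i 0 + x := by omega
    rw [colLen_tail, colHt_cons, ih', hs, ho, add_comm]

theorem exists_isKSkew {k : ℕ} {l : List ℕ} (hl : KBounded k l) :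
    Antitone (colHt k l) ∧ ∃ o i, IsKSkew k l o i := by
  induction l with
  | nil =>
    refine ⟨fun _ _ _ => le_rfl, [], [], hl.1, hl.1, fun _ => le_rfl, fun _ => rfl, ?_, ?_⟩
    · intro r c _ h
      simp [part_nil] at h
    · intro r c h
      simp [part_nil] at h
  | cons x t ih =>
    obtain ⟨ht, hx, hxk, htx⟩ := hl.of_cons
    obtain ⟨hanti, o, i, hskew⟩ := ih ht
    have hC := hskew.colLen_eq ht
    obtain ⟨ho, hi, hsub, hrow, hcell, hinner⟩ := hskew
    have hne : ∃ j, x + colHt k t j ≤ k :=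
      ⟨part o 0, by rw [← hC, colLen_eq_zero ho le_rfl]; exact hxk⟩
    have hspec := rowStart_spec hne
    have hlt := fun j => lt_of_lt_rowStart (k := k) (x := x) (C := colHt k t) (j := j)
    have hcons := colHt_cons k x t
    set s := rowStart k x (colHt k t)
    refine ⟨antitone_nat_of_succ_le fun j => ?_, ?_⟩
    · rw [hcons, hcons]
      have hmono := hanti (Nat.le_succ j)
      rw [Nat.succ_eq_add_one] at hmono
      rcases Nat.lt_trichotomy s (j + 1) with h | h | h
      · split_ifs <;> omega
      · rw [h] at hspec
        have := hlt j (by omega)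
        split_ifs <;> omega
      · split_ifs <;> omega
    have his : part i 0 ≤ s := by
      by_contra! hsi
      have h1 := hinner 0 s hsi
      have h2 := colLen_tail o i s
      rw [if_neg (by omega), zero_add, hC] at h2
      rw [hookLen_zero, max_eq_right hsi.le, hrow 0, ← h2] at h1
      omega
    have hos : part o 0 ≤ s + x := by
      have := hrow 0
      have := hsub 0
      omega
    obtain ⟨o', ho', ho0, rfl⟩ := ho.exists_tail_eq hos
    obtain ⟨i', hi', hi0, rfl⟩ := hi.exists_tail_eq his
    refine ⟨o', i', ho', hi', fun r => ?_, fun r => ?_, fun r c => ?_, fun r c => ?_⟩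
    · cases r with
      | zero => omega
      | succ r => simpa only [part_tail] using hsub r
    · cases r with
      | zero => rw [part_cons_zero]; omega
      | succ r => simpa only [part_tail, part_cons_succ] using hrow r
    · cases r with
      | zero =>
        intro h1 h2
        have := hanti (show s ≤ c by omega)
        rw [hookLen_zero, max_eq_left h1, hC]
        omega
      | succ r => simpa only [part_tail, hookLen_succ] using hcell r c
    · cases r with
      | zero =>
        intro h1
        have := hlt c (by omega)
        rw [hookLen_zero, max_eq_right h1.le, hC]
        omega
      | succ r => simpa only [part_tail, hookLen_succ] using hinner r c

theorem part_map_range (f : ℕ → ℕ) (n j : ℕ) :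
    part ((List.range n).map f) j = if j < n then f j else 0 := by
  split_ifs with h
  · simp [part, h]
  · simp [part, not_lt.mp h]

theorem part_filter_ne_zero {l : List ℕ} (hl : l.Pairwise (· ≥ ·)) (j : ℕ) :
    part (l.filter (fun x => decide (x ≠ 0))) j = part l j := by
  induction l generalizing j with
  | nil => rfl
  | cons a t ih =>
    obtain ⟨hat, ht⟩ := List.pairwise_cons.mp hl
    by_cases ha : a = 0
    · subst ha
      have h0 : ∀ x ∈ (0 :: t), x = 0 := by
        intro x hx
        rcases List.mem_cons.mp hx with rfl | hx
        · rfl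
        · exact Nat.le_zero.mp (hat x hx)
      have hnil : (0 :: t).filter (fun x => decide (x ≠ 0)) = [] := by
        rw [List.filter_eq_nil_iff]
        intro x hx
        simp [h0 x hx]
      rw [hnil, part_nil]
      rcases part_mem_or_eq_zero (0 :: t) j with h | h
      · exact (h0 _ h).symm
      · exact h.symm
    · rw [List.filter_cons_of_pos (by simpa using ha)]
      cases j with
      | zero => rw [part_cons_zero, part_cons_zero]
      | succ j => rw [part_cons_succ, part_cons_succ, ih ht]

theorem part_kConj {k : ℕ} {l : List ℕ} (hl : KBounded k l) (j : ℕ) :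
    part (kConj k l) j = colHt k l j := by
  obtain ⟨hanti, o, i, hskew⟩ := exists_isKSkew hl
  have h : ∃ p : List ℕ × List ℕ, IsKSkew k l p.1 p.2 := ⟨(o, i), hskew⟩
  have hk : kConj k l = skewCols h.choose.1 h.choose.2 := by
    unfold kConj
    rw [dif_pos h]
  have hC := h.choose_spec.colLen_eq hl
  rw [hk, skewCols, part_filter_ne_zero]
  · by_cases hj : j < part h.choose.1 0
    · rw [part_map_range, if_pos hj, hC]
    · rw [part_map_range, if_neg hj, ← hC, colLen_eq_zero h.choose_spec.1 (not_lt.mp hj)]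
  · rw [List.pairwise_map]
    refine List.pairwise_lt_range.imp fun hab => ?_
    simpa only [hC] using hanti hab.le

theorem colHt_add_mul {k m : ℕ} (hm : 1 ≤ m) (hmk : m ≤ k) {l : List ℕ} (hl : KBounded k l)
    (hlm : ∀ x ∈ l, x ≤ m) (hcount : l.countP (· < m) ≤ k - m + 1) {j : ℕ} (hj : j < m) (q : ℕ) :
    colHt k l (j + m * q) = min (k - m + 1) (l.countP (j < ·) - q * (k - m + 1)) := by
  induction l generalizing j q with
  | nil => simp [colHt]
  | cons x t ih =>
    obtain ⟨ht, hx, hxk, htx⟩ := hl.of_cons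
    have hxm : x ≤ m := hlm x (by simp)
    have hcount' : t.countP (· < m) ≤ k - m + 1 := by
      rw [List.countP_cons] at hcount
      omega
    have ih' := fun {j} hj q =>
      ih ht (fun y hy => hlm y (List.mem_cons_of_mem _ hy)) hcount' (j := j) hj q
    have hanti := (exists_isKSkew ht).1
    rw [colHt_cons, List.countP_cons, ih' hj]
    rcases hxm.lt_or_eq with hlt | rfl
    · have hall : t.countP (· < m) = t.length := by
        rw [List.countP_eq_length]
        intro y hy
        have := ht.1.le_part_zero hy
        simp only [decide_eq_true_eq]
        omega
      have hlen : t.length + 1 ≤ k - m + 1 := by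
        rw [List.countP_cons, hall] at hcount
        simpa [hlt] using hcount
      have hle0 : t.countP (0 < ·) ≤ t.length := List.countP_le_length
      have hlej : t.countP (j < ·) ≤ t.length := List.countP_le_length
      have h0 : rowStart k x (colHt k t) = 0 := by
        refine Nat.le_zero.mp (rowStart_le ?_)
        have := ih' (j := 0) (by omega) 0
        simp only [mul_zero, add_zero, zero_mul, Nat.sub_zero] at this
        omega
      rw [h0]
      rcases Nat.eq_zero_or_pos q with rfl | hq
      · simp only [decide_eq_true_eq]
        split_ifs <;> omega
      · have h1 : m ≤ m * q := Nat.le_mul_of_pos_right m hq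
        have h2 : k - m + 1 ≤ q * (k - m + 1) := Nat.le_mul_of_pos_left _ hq
        simp only [decide_eq_true_eq]
        split_ifs <;> omega
    · have hne : ∃ c, x + colHt k t c ≤ k := by
        by_contra! hne
        obtain ⟨-, o, i, hskew⟩ := exists_isKSkew ht
        have h1 := hne (part o 0)
        rw [← hskew.colLen_eq ht, colLen_eq_zero hskew.1 le_rfl] at h1
        omega
      have hspec := rowStart_spec hne
      have hiff : ∀ c, rowStart k x (colHt k t) ≤ c ↔ colHt k t c < k - x + 1 := by
        intro c
        constructor
        · intro h
          have := hanti h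
          omega
        · intro h
          exact rowStart_le (by omega)
      have hleft : rowStart k x (colHt k t) ≤ j + x * q ↔
          t.countP (j < ·) < q * (k - x + 1) + (k - x + 1) := by
        rw [hiff, ih' hj]
        omega
      have hright : j + x * q < rowStart k x (colHt k t) + x ↔
          q * (k - x + 1) ≤ t.countP (j < ·) := by
        cases q with
        | zero => simp only [mul_zero, zero_mul]; omega
        | succ q =>
          have h1 := hiff (j + x * q)
          rw [ih' hj] at h1
          have h2 : x * (q + 1) = x * q + x := by ring
          have h3 : (q + 1) * (k - x + 1) = q * (k - x + 1) + (k - x + 1) := by ring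
          rw [h2, h3]
          omega
      simp only [hleft, hright, decide_eq_true_eq, hj, if_true]
      split_ifs <;> omega

theorem min_countP_le_colHt_zero {k m : ℕ} (hmk : m ≤ k) {l : List ℕ} (hl : ∀ x ∈ l, 0 < x) :
    min (l.countP (· < m)) (k - m + 2) ≤ colHt k l 0 := by
  induction l with
  | nil => simp
  | cons x t ih =>
    have ih' := ih fun y hy => hl y (List.mem_cons_of_mem _ hy)
    have hx := hl x (by simp)
    rw [List.countP_cons, colHt_cons]
    simp only [decide_eq_true_eq]
    by_cases hxm : x < m
    · by_cases hC : colHt k t 0 ≤ k - m + 1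
      · have h0 : rowStart k x (colHt k t) = 0 := Nat.le_zero.mp (rowStart_le (by omega))
        rw [h0, if_pos hxm, if_pos (by omega)]
        omega
      · omega
    · rw [if_neg hxm]
      omega

theorem SubDiag.countP_le {l l' : List ℕ} (h : SubDiag l l') (j : ℕ) :
    l.countP (j < ·) ≤ l'.countP (j < ·) := by
  induction l generalizing l' with
  | nil => simp
  | cons a t ih =>
    have h0 := h 0
    have ht : SubDiag t l'.tail := fun i => by
      simpa only [part_tail, part_cons_succ] using h (i + 1)
    have ih' := ih ht
    rw [part_cons_zero] at h0
    cases l' with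
    | nil =>
      rw [part_nil] at h0
      rw [List.countP_cons]
      simp only [List.tail_nil, List.countP_nil] at ih' ⊢
      simp only [decide_eq_true_eq]
      split_ifs <;> omega
    | cons b t' =>
      rw [part_cons_zero] at h0
      rw [List.tail_cons] at ih'
      rw [List.countP_cons, List.countP_cons]
      simp only [decide_eq_true_eq]
      split_ifs <;> omega

theorem KLe.kBounded_and_countP_le {k m n : ℕ} (hm : 1 ≤ m) (hmk : m ≤ k) {l : List ℕ}
    (h : KLe k l (List.replicate n m)) :
    KBounded k l ∧ (∀ x ∈ l, x ≤ m) ∧ l.countP (· < m) ≤ k - m + 1 := by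
  induction h using Relation.ReflTransGen.head_induction_on with
  | refl =>
    refine ⟨⟨⟨?_, ?_⟩, ?_⟩, ?_, ?_⟩
    · simp [List.pairwise_replicate]
    · intro x hx
      have := List.eq_of_mem_replicate hx
      omega
    · rcases part_mem_or_eq_zero (List.replicate n m) 0 with h | h
      · have := List.eq_of_mem_replicate h
        omega
      · omega
    · exact fun x hx => (List.eq_of_mem_replicate hx).le
    · simp [List.countP_replicate]
  | head hcover _ ih =>
    obtain ⟨hl, hl', hsub, hconj, -⟩ := hcover
    obtain ⟨-, hm', hcount⟩ := ih
    refine ⟨hl, fun x hx => ?_, ?_⟩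
    · obtain ⟨i, rfl⟩ := exists_part_eq_of_mem hx
      have := hsub i
      rcases part_mem_or_eq_zero _ i with h | h
      · exact this.trans (hm' _ h)
      · omega
    · have h1 := hconj 0
      rw [part_kConj hl, part_kConj hl'] at h1
      have h2 := colHt_add_mul hm hmk hl' hm' hcount (j := 0) hm 0
      rw [mul_zero, add_zero] at h2
      have h3 := min_countP_le_colHt_zero hmk hl.1.2
      omega

/-- for `λ, μ ∈ L^k(m,n)`, `μ` is covered by `λ` in the `k`-Young order
iff `μ ⊆ λ` and `|λ| = |μ| + 1`. -/
theorem kCover_iff_in_ideal (k m n : ℕ) (hm : 1 ≤ m) (hmk : m ≤ k) (lam μ : List ℕ)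
    (hlam : KLe k lam (List.replicate n m)) (hμ : KLe k μ (List.replicate n m)) :
    KCover k μ lam ↔ SubDiag μ lam ∧ lam.sum = μ.sum + 1 := by
  obtain ⟨hbl, hlm, hlc⟩ := KLe.kBounded_and_countP_le hm hmk hlam
  obtain ⟨hbμ, hμm, hμc⟩ := KLe.kBounded_and_countP_le hm hmk hμ
  refine ⟨fun h => ⟨h.2.2.1, h.2.2.2.2⟩, fun h => ⟨hbμ, hbl, h.1, fun c => ?_, h.2⟩⟩
  have hc : c % m < m := Nat.mod_lt _ hm
  rw [part_kConj hbμ, part_kConj hbl, ← Nat.mod_add_div c m,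
    colHt_add_mul hm hmk hbμ hμm hμc hc, colHt_add_mul hm hmk hbl hlm hlc hc]
  have := h.1.countP_le (c % m)
  omega
end

section
/- Let 1 ≤ m ≤ k and n ≥ k−m+1. Then the number of partitions λ contained in the rectangle (m^n) having at most k−m+1 parts strictly smaller than m (i.e., the number of elements of L^k(m,n)) equals C(k+1, m) + (n−k+m−1)·C(k, m−1), where C(·,·) denotes the binomial coefficient. -/
/-- The partitions with all parts at most `N` and at most `r` parts. -/
def boxPartitions (N r : ℕ) : Set (List ℕ) :=
  {l | IsPartition l ∧ (∀ x ∈ l, x ≤ N) ∧ l.length ≤ r}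

/-- The partitions in an `n × m` box with at most `r` parts strictly smaller than `m`. -/
def boxPartitionsFewSmall (m n r : ℕ) : Set (List ℕ) :=
  {l | l ∈ boxPartitions m n ∧ (l.filter (fun x => decide (x < m))).length ≤ r}

theorem isPartition_nil : IsPartition [] := by simp [IsPartition]

theorem isPartition_cons {a : ℕ} {l : List ℕ} :
    IsPartition (a :: l) ↔ 0 < a ∧ (∀ x ∈ l, x ≤ a) ∧ IsPartition l := by
  simp only [IsPartition, List.pairwise_cons, List.forall_mem_cons]
  tauto

theorem IsPartition.subDiag_replicate_iff {l : List ℕ} (hl : IsPartition l) (m n : ℕ) :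
    SubDiag l (List.replicate n m) ↔ (∀ x ∈ l, x ≤ m) ∧ l.length ≤ n := by
  have part_replicate (i : ℕ) : part (List.replicate n m) i = if i < n then m else 0 := by
    simp only [part, List.getD_eq_getElem?_getD, List.getElem?_replicate]
    split_ifs <;> rfl
  have part_of_lt {i : ℕ} (hi : i < l.length) : part l i = l[i] := by simp [part, hi]
  constructor
  · intro h
    constructor
    · intro x hx
      obtain ⟨i, hi, rfl⟩ := List.mem_iff_getElem.1 hx
      have := h i
      rw [part_of_lt hi, part_replicate] at this
      split_ifs at this <;> omega
    · by_contra! hlen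
      have := h n
      rw [part_of_lt hlen, part_replicate, if_neg (lt_irrefl n)] at this
      have := hl.2 _ (List.getElem_mem hlen)
      omega
  · rintro ⟨hle, hlen⟩ i
    rcases lt_or_ge i l.length with hi | hi
    · rw [part_of_lt hi, part_replicate, if_pos (by omega)]
      exact hle _ (List.getElem_mem hi)
    · simp [part, hi]

theorem boxPartitions_zero_left (r : ℕ) : boxPartitions 0 r = {[]} := by
  ext l
  cases l with
  | nil => simp [boxPartitions, isPartition_nil]
  | cons a l =>
    simp only [boxPartitions, Set.mem_ofPred_eq, isPartition_cons, List.forall_mem_cons,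
      Set.mem_singleton_iff, reduceCtorEq, iff_false]
    omega

theorem boxPartitions_zero_right (N : ℕ) : boxPartitions N 0 = {[]} := by
  ext l
  cases l <;> simp [boxPartitions, isPartition_nil]

theorem boxPartitions_succ_succ (N r : ℕ) :
    boxPartitions (N + 1) (r + 1) =
      boxPartitions N (r + 1) ∪ List.cons (N + 1) '' boxPartitions (N + 1) r := by
  ext l
  cases l with
  | nil => simp [boxPartitions, isPartition_nil]
  | cons a l =>
    simp only [boxPartitions, Set.mem_union, Set.mem_image, Set.mem_ofPred_eq, isPartition_cons,
      List.forall_mem_cons, List.length_cons, List.cons.injEq]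
    constructor
    · rintro ⟨⟨h0, hle, hl⟩, ⟨ha, -⟩, hlen⟩
      rcases Nat.lt_or_ge N a with h | h
      · obtain rfl : a = N + 1 := by omega
        exact Or.inr ⟨l, ⟨hl, hle, by omega⟩, rfl, rfl⟩
      · exact Or.inl ⟨⟨h0, hle, hl⟩, ⟨h, fun x hx => (hle x hx).trans h⟩, hlen⟩
    · rintro (⟨h, ⟨ha, hle⟩, hlen⟩ | ⟨l, ⟨hl, hle, hlen⟩, rfl, rfl⟩)
      · exact ⟨h, ⟨by omega, fun x hx => (hle x hx).trans (by omega)⟩, hlen⟩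
      · exact ⟨⟨by omega, hle, hl⟩, ⟨le_rfl, hle⟩, by omega⟩

theorem disjoint_boxPartitions_image_cons (N r s : ℕ) :
    Disjoint (boxPartitions N r) (List.cons (N + 1) '' boxPartitions (N + 1) s) := by
  rw [Set.disjoint_left]
  rintro _ ⟨-, hle, -⟩ ⟨l, -, rfl⟩
  have := hle (N + 1) (by simp)
  omega

theorem finite_boxPartitions (N r : ℕ) : (boxPartitions N r).Finite := by
  induction N generalizing r with
  | zero => simp [boxPartitions_zero_left]
  | succ N ihN =>
    induction r with
    | zero => simp [boxPartitions_zero_right]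
    | succ r ihr =>
      rw [boxPartitions_succ_succ]
      exact (ihN _).union (ihr.image _)

theorem ncard_boxPartitions (N r : ℕ) : (boxPartitions N r).ncard = (N + r).choose r := by
  induction N generalizing r with
  | zero => simp [boxPartitions_zero_left]
  | succ N ihN =>
    induction r with
    | zero => simp [boxPartitions_zero_right]
    | succ r ihr =>
      rw [boxPartitions_succ_succ,
        Set.ncard_union_eq (disjoint_boxPartitions_image_cons _ _ _) (finite_boxPartitions _ _)
          ((finite_boxPartitions _ _).image _),
        Set.ncard_image_of_injective _ List.cons_injective, ihN, ihr,
        show N + 1 + (r + 1) = (N + 1 + r) + 1 by omega, Nat.choose_succ_succ,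
        show N + (r + 1) = N + 1 + r by omega, add_comm]

theorem finite_boxPartitionsFewSmall (m n r : ℕ) : (boxPartitionsFewSmall m n r).Finite :=
  (finite_boxPartitions m n).subset fun _ h => h.1

theorem boxPartitionsFewSmall_self (m r : ℕ) :
    boxPartitionsFewSmall m r r = boxPartitions m r := by
  ext l
  exact ⟨fun h => h.1, fun h => ⟨h, (List.length_filter_le _ _).trans h.2.2⟩⟩

theorem IsPartition.eq_replicate_append_filter {m : ℕ} {l : List ℕ} (hl : IsPartition l)
    (hle : ∀ x ∈ l, x ≤ m) :
    l = List.replicate (l.length - (l.filter (fun x => decide (x < m))).length) m ++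
      l.filter (fun x => decide (x < m)) := by
  induction l with
  | nil => simp
  | cons a l ih =>
    rw [isPartition_cons] at hl
    rw [List.forall_mem_cons] at hle
    rcases hle.1.lt_or_eq with h | rfl
    · have : (a :: l).filter (fun x => decide (x < m)) = a :: l := by
        rw [List.filter_eq_self]
        simpa [h] using fun x hx => (hl.2.1 x hx).trans_lt h
      simp [this]
    · have hlen := List.length_filter_le (fun x => decide (x < a)) l
      rw [List.filter_cons_of_neg (by simp), List.length_cons, Nat.sub_add_comm hlen,
        List.replicate_succ, List.cons_append, ← ih hl.2.2 hle.2]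

theorem filter_lt_replicate_append {m : ℕ} {l : List ℕ} (j : ℕ) (hl : ∀ x ∈ l, x < m) :
    (List.replicate j m ++ l).filter (fun x => decide (x < m)) = l := by
  rw [List.filter_append, List.filter_replicate_of_neg (by simp), List.nil_append,
    List.filter_eq_self]
  simpa using hl

theorem IsPartition.replicate_append {m : ℕ} (hm : 0 < m) {l : List ℕ} (hl : IsPartition l)
    (hle : ∀ x ∈ l, x ≤ m) (j : ℕ) : IsPartition (List.replicate j m ++ l) := by
  induction j with
  | zero => simpa using hl
  | succ j ih =>
    rw [List.replicate_succ, List.cons_append, isPartition_cons]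
    refine ⟨hm, fun x hx => ?_, ih⟩
    rcases List.mem_append.1 hx with h | h
    · exact (List.eq_of_mem_replicate h).le
    · exact hle x h

theorem boxPartitionsFewSmall_succ {N n r : ℕ} (hr : r ≤ n + 1) :
    boxPartitionsFewSmall (N + 1) (n + 1) r = boxPartitionsFewSmall (N + 1) n r ∪
      (fun l => List.replicate (n + 1 - l.length) (N + 1) ++ l) '' boxPartitions N r := by
  ext l
  constructor
  · rintro ⟨⟨hl, hle, hlen⟩, hsmall⟩
    rcases Nat.lt_or_ge n l.length with h | h
    · obtain hn : l.length = n + 1 := by omega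
      refine Or.inr ⟨l.filter (fun x => decide (x < N + 1)), ⟨⟨hl.1.filter _, ?_⟩, ?_, hsmall⟩, ?_⟩
      · exact fun x hx => hl.2 x (List.mem_of_mem_filter hx)
      · intro x hx
        have := List.of_mem_filter hx
        simp only [decide_eq_true_eq] at this
        omega
      · simpa only [hn] using (hl.eq_replicate_append_filter hle).symm
    · exact Or.inl ⟨⟨hl, hle, h⟩, hsmall⟩
  · rintro (⟨⟨hl, hle, hlen⟩, hsmall⟩ | ⟨l, ⟨hl, hle, hlen⟩, rfl⟩)
    · exact ⟨⟨hl, hle, by omega⟩, hsmall⟩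
    · have hle' : ∀ x ∈ l, x ≤ N + 1 := fun x hx => (hle x hx).trans (by omega)
      refine ⟨⟨hl.replicate_append (by omega) hle' _, fun x hx => ?_, ?_⟩, ?_⟩
      · rcases List.mem_append.1 hx with h | h
        · exact (List.eq_of_mem_replicate h).le
        · exact hle' x h
      · simp only [List.length_append, List.length_replicate]
        omega
      · rwa [filter_lt_replicate_append _ fun x hx => Nat.lt_succ_of_le (hle x hx)]

theorem injOn_replicate_append (N n r : ℕ) :
    Set.InjOn (fun l => List.replicate (n - l.length) (N + 1) ++ l) (boxPartitions N r) := by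
  intro l hl l' hl' h
  have := congrArg (List.filter (fun x => decide (x < N + 1))) h
  simpa only [filter_lt_replicate_append _ fun x hx => Nat.lt_succ_of_le (hl.2.1 x hx),
    filter_lt_replicate_append _ fun x hx => Nat.lt_succ_of_le (hl'.2.1 x hx)] using this

theorem ncard_boxPartitionsFewSmall_add (N r d : ℕ) :
    (boxPartitionsFewSmall (N + 1) (r + d) r).ncard =
      (N + 1 + r).choose r + d * (N + r).choose r := by
  induction d with
  | zero => simp [boxPartitionsFewSmall_self, ncard_boxPartitions]
  | succ d ih =>
    have hdisj : Disjoint (boxPartitionsFewSmall (N + 1) (r + d) r)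
        ((fun l => List.replicate (r + d + 1 - l.length) (N + 1) ++ l) '' boxPartitions N r) := by
      rw [Set.disjoint_left]
      rintro _ ⟨⟨-, -, hlen⟩, -⟩ ⟨l, -, rfl⟩
      simp only [List.length_append, List.length_replicate] at hlen
      omega
    rw [← add_assoc, boxPartitionsFewSmall_succ (by omega),
      Set.ncard_union_eq hdisj (finite_boxPartitionsFewSmall _ _ _)
        ((finite_boxPartitions _ _).image _),
      (injOn_replicate_append _ _ _).ncard_image, ih, ncard_boxPartitions]
    ring

/-- the number of elements of `L^k(m,n)` is
`C(k+1, m) + (n-k+m-1)·C(k, m-1)`. -/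
theorem kIdeal_card (k m n : ℕ) (hm : 1 ≤ m) (hmk : m ≤ k) (hn : k - m + 1 ≤ n) :
    {l : List ℕ | IsPartition l ∧ SubDiag l (List.replicate n m) ∧
      (l.filter (fun x => decide (x < m))).length ≤ k - m + 1}.ncard
    = Nat.choose (k + 1) m + (n - (k - m + 1)) * Nat.choose k (m - 1) := by
  have hset : {l : List ℕ | IsPartition l ∧ SubDiag l (List.replicate n m) ∧
      (l.filter (fun x => decide (x < m))).length ≤ k - m + 1} =
      boxPartitionsFewSmall m n (k - m + 1) := by
    ext l
    simp only [boxPartitionsFewSmall, boxPartitions, Set.mem_ofPred_eq, and_assoc]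
    refine and_congr_right fun hl => ?_
    rw [hl.subDiag_replicate_iff, and_assoc]
  rw [hset]
  obtain ⟨N, rfl⟩ := Nat.exists_eq_add_of_le' hm
  obtain ⟨d, rfl⟩ := Nat.exists_eq_add_of_le hn
  rw [ncard_boxPartitionsFewSmall_add, Nat.add_sub_cancel_left, Nat.add_sub_cancel,
    show N + 1 + (k - (N + 1) + 1) = k + 1 by omega, show N + (k - (N + 1) + 1) = k by omega,
    Nat.choose_symm_of_eq_add (show k + 1 = (k - (N + 1) + 1) + (N + 1) by omega),
    Nat.choose_symm_of_eq_add (show k = (k - (N + 1) + 1) + N by omega)]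
end
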